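/- Let $(\Omega,\Sigma,\mu)$ be a probability space, $N \ge 1$, and $P = \mu^{\otimes N}$ on $\Omega^N$. For $A \subseteq \Omega^N$ and $x \in \Omega^N$, let $U_A(x) = \{s \in \{0,1\}^N : \exists y \in A,\ \forall i \le N,\ s_i = 0 \Rightarrow x_i = y_i\}$, let $V_A(x) \subseteq \mathbb{R}^N$ be the convex hull of $U_A(x)$, and let $f_c(A,x)$ be the Euclidean distance from $0$ to $V_A(x)$. Then for every measurable $A$ with $P(A) > 0$: $\int^* \exp\big(\tfrac14 f_c(A,x)^2\big)\, dP(x) \le \frac{1}{P(A)}$. In particular, for every $t > 0$, $P^*(\{x : f_c(A,x) > t\}) \le \frac{1}{P(A)} e^{-t^2/4}$. -/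

import Mathlib

open MeasureTheory ENNReal

/-- The upper (outer) integral: infimum of `∫⁻ g` over measurable `g ≥ f`. -/
noncomputable def upperLintegral {α : Type*} [MeasurableSpace α] (μ : Measure α)
    (f : α → ℝ≥0∞) : ℝ≥0∞ :=
  ⨅ (g : α → ℝ≥0∞) (_ : Measurable g) (_ : ∀ x, f x ≤ g x), ∫⁻ x, g x ∂μ

/-- The product probability `μ^{⊗N}` on `Ω^N`. -/
noncomputable def piP {Ω : Type*} [MeasurableSpace Ω] (μ : Measure Ω) [SigmaFinite μ]
    (N : ℕ) : Measure (Fin N → Ω) :=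
  Measure.pi fun _ : Fin N => μ

/-- `U_A(x) = {s ∈ {0,1}^N : ∃ y ∈ A, s_i = 0 → x_i = y_i}`, viewed inside
Euclidean space `ℝ^N`. -/
def convUA {N : ℕ} {Ω : Type*} (A : Set (Fin N → Ω)) (x : Fin N → Ω) :
    Set (EuclideanSpace ℝ (Fin N)) :=
  {s | (∀ i, s i = 0 ∨ s i = 1) ∧ ∃ y ∈ A, ∀ i, s i = 0 → x i = y i}

/-- `f_c(A,x)`: the Euclidean distance from `0` to the convex hull `V_A(x)` of
`U_A(x)`. -/
noncomputable def fConv {N : ℕ} {Ω : Type*} (A : Set (Fin N → Ω)) (x : Fin N → Ω) : ℝ :=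
  Metric.infDist (0 : EuclideanSpace ℝ (Fin N)) (convexHull ℝ (convUA A x))

/-- The indicator vector of a Boolean point of the cube. -/
noncomputable def cubeVec {n : ℕ} (b : Fin n → Bool) : EuclideanSpace ℝ (Fin n) :=
  WithLp.toLp 2 fun i => if b i then 1 else 0

/-- The distance from the origin to the convex hull of a set of vertices of the cube. -/
noncomputable def cubeDist {n : ℕ} (S : Set (Fin n → Bool)) : ℝ :=
  Metric.infDist 0 (convexHull ℝ (cubeVec '' S))

/-- Prepending a real coordinate to a Euclidean vector. -/
noncomputable def consVec {n : ℕ} (t : ℝ) (v : EuclideanSpace ℝ (Fin n)) :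
    EuclideanSpace ℝ (Fin (n + 1)) :=
  WithLp.toLp 2 (Fin.cons t v)

lemma cubeDist_nonneg {n : ℕ} (S : Set (Fin n → Bool)) : 0 ≤ cubeDist S :=
  Metric.infDist_nonneg

lemma exists_norm_eq_cubeDist {n : ℕ} {S : Set (Fin n → Bool)} (hS : S.Nonempty) :
    ∃ v ∈ convexHull ℝ (cubeVec '' S), ‖v‖ = cubeDist S := by
  have hc : IsCompact (convexHull ℝ (cubeVec '' S)) :=
    Set.Finite.isCompact_convexHull ℝ ((Set.toFinite S).image _)
  obtain ⟨v, hv, h⟩ := hc.exists_infDist_eq_dist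
    (convexHull_nonempty_iff.2 (hS.image _)) 0
  exact ⟨v, hv, by rw [cubeDist, h, dist_zero_left]⟩

lemma cubeDist_le_norm {n : ℕ} {S : Set (Fin n → Bool)} {v : EuclideanSpace ℝ (Fin n)}
    (hv : v ∈ convexHull ℝ (cubeVec '' S)) : cubeDist S ≤ ‖v‖ := by
  rw [← dist_zero_left]
  exact Metric.infDist_le_dist_of_mem hv

lemma norm_consVec_sq {n : ℕ} (t : ℝ) (v : EuclideanSpace ℝ (Fin n)) :
    ‖consVec t v‖ ^ 2 = t ^ 2 + ‖v‖ ^ 2 := by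
  simp [EuclideanSpace.norm_sq_eq, consVec, Fin.sum_univ_succ]

lemma combo_consVec {n : ℕ} (a b s t : ℝ) (v w : EuclideanSpace ℝ (Fin n)) :
    a • consVec s v + b • consVec t w = consVec (a * s + b * t) (a • v + b • w) := by
  ext i
  refine Fin.cases ?_ (fun i => ?_) i <;> simp [consVec]

lemma consVec_cubeVec {n : ℕ} (c : Bool) (b : Fin n → Bool) :
    consVec (if c then 1 else 0) (cubeVec b) = cubeVec (Fin.cons c b : Fin (n + 1) → Bool) := by
  ext i
  refine Fin.cases ?_ (fun i => ?_) i <;> simp [consVec, cubeVec]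

lemma consVec_mem_convexHull {n : ℕ} {T : Set (Fin (n + 1) → Bool)} {S : Set (Fin n → Bool)}
    (c : Bool) (hS : ∀ b ∈ S, (Fin.cons c b : Fin (n + 1) → Bool) ∈ T)
    {v : EuclideanSpace ℝ (Fin n)} (hv : v ∈ convexHull ℝ (cubeVec '' S)) :
    consVec (if c then 1 else 0) v ∈ convexHull ℝ (cubeVec '' T) := by
  have hsub : cubeVec '' S ⊆
      {v | consVec (if c then 1 else 0) v ∈ convexHull ℝ (cubeVec '' T)} := by
    rintro _ ⟨b, hb, rfl⟩
    rw [Set.mem_ofPred_eq, consVec_cubeVec]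
    exact subset_convexHull ℝ _ ⟨_, hS b hb, rfl⟩
  refine convexHull_min hsub ?_ hv
  intro x hx y hy a b ha hb hab
  have := (convex_convexHull ℝ (cubeVec '' T)) hx hy ha hb hab
  rw [combo_consVec, ← add_mul, hab, one_mul] at this
  exact this

lemma cubeDist_sq_le_one_add {n : ℕ} {T : Set (Fin (n + 1) → Bool)} {S : Set (Fin n → Bool)}
    (hne : S.Nonempty) (hS : ∀ b ∈ S, (Fin.cons true b : Fin (n + 1) → Bool) ∈ T) :
    cubeDist T ^ 2 ≤ 1 + cubeDist S ^ 2 := by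
  obtain ⟨v, hv, hn⟩ := exists_norm_eq_cubeDist hne
  have h := cubeDist_le_norm (consVec_mem_convexHull true hS hv)
  calc cubeDist T ^ 2 ≤ ‖consVec (if true then 1 else 0) v‖ ^ 2 :=
        pow_le_pow_left₀ (cubeDist_nonneg _) h 2
    _ = 1 + cubeDist S ^ 2 := by rw [norm_consVec_sq, hn]; simp

lemma cubeDist_sq_le_convex {n : ℕ} {T : Set (Fin (n + 1) → Bool)} {S₀ S₁ : Set (Fin n → Bool)}
    (hne₀ : S₀.Nonempty) (hne₁ : S₁.Nonempty)
    (h₀ : ∀ b ∈ S₀, (Fin.cons false b : Fin (n + 1) → Bool) ∈ T)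
    (h₁ : ∀ b ∈ S₁, (Fin.cons true b : Fin (n + 1) → Bool) ∈ T)
    {a : ℝ} (ha₀ : 0 ≤ a) (ha₁ : a ≤ 1) :
    cubeDist T ^ 2 ≤ (1 - a) ^ 2 + a * cubeDist S₀ ^ 2 + (1 - a) * cubeDist S₁ ^ 2 := by
  obtain ⟨v, hv, hvn⟩ := exists_norm_eq_cubeDist hne₀
  obtain ⟨w, hw, hwn⟩ := exists_norm_eq_cubeDist hne₁
  have hmem := (convex_convexHull ℝ (cubeVec '' T)) (consVec_mem_convexHull false h₀ hv)
    (consVec_mem_convexHull true h₁ hw) ha₀ (sub_nonneg.2 ha₁) (by ring)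
  rw [combo_consVec] at hmem
  have h := cubeDist_le_norm hmem
  have hnorm : ‖a • v + (1 - a) • w‖ ≤ a * ‖v‖ + (1 - a) * ‖w‖ := by
    refine (norm_add_le _ _).trans_eq ?_
    rw [norm_smul_of_nonneg ha₀, norm_smul_of_nonneg (sub_nonneg.2 ha₁)]
  have hsq : ‖a • v + (1 - a) • w‖ ^ 2 ≤ a * ‖v‖ ^ 2 + (1 - a) * ‖w‖ ^ 2 := by
    nlinarith [pow_le_pow_left₀ (norm_nonneg _) hnorm 2,
      mul_nonneg (mul_nonneg ha₀ (sub_nonneg.2 ha₁)) (sq_nonneg (‖v‖ - ‖w‖))]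
  have h2 := pow_le_pow_left₀ (cubeDist_nonneg _) h 2
  rw [norm_consVec_sq] at h2
  simp only [Bool.false_eq_true, if_false, if_true] at h2
  rw [← hvn, ← hwn]
  nlinarith

/-- The set of patterns `b` such that resampling the coordinates of `x` selected by `b` hits `A`
with positive probability. -/
def essPattern {Ω : Type*} [MeasurableSpace Ω] (μ : Measure Ω) [IsProbabilityMeasure μ] {n : ℕ}
    (A : Set (Fin n → Ω)) (x : Fin n → Ω) : Set (Fin n → Bool) :=
  {b | 0 < piP μ n {y | (fun i => if b i then y i else x i) ∈ A}}

/-- The exponential weight attached to the measurable version of the convex-hull distance. -/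
noncomputable def essExp {Ω : Type*} [MeasurableSpace Ω] (μ : Measure Ω) [IsProbabilityMeasure μ]
    {n : ℕ} (A : Set (Fin n → Ω)) (x : Fin n → Ω) : ℝ≥0∞ :=
  ENNReal.ofReal (Real.exp (cubeDist (essPattern μ A x) ^ 2 / 4))

lemma ite_cons_cons {Ω : Type*} {n : ℕ} (c : Bool) (b : Fin n → Bool) (η ω : Ω) (y x : Fin n → Ω) :
    (fun i => if (Fin.cons c b : Fin (n + 1) → Bool) i then (Fin.cons η y : Fin (n + 1) → Ω) i
      else (Fin.cons ω x : Fin (n + 1) → Ω) i) =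
    (Fin.cons (if c then η else ω) (fun i => if b i then y i else x i) : Fin (n + 1) → Ω) := by
  ext i
  refine Fin.cases ?_ (fun i => ?_) i <;> simp

section Measure

variable {Ω : Type*} [MeasurableSpace Ω] (μ : Measure Ω) [IsProbabilityMeasure μ]

instance isProbabilityMeasure_piP (n : ℕ) : IsProbabilityMeasure (piP μ n) := by
  unfold piP; infer_instance

lemma essPattern_nonempty {n : ℕ} {A : Set (Fin n → Ω)} (hA : 0 < piP μ n A) (x : Fin n → Ω) :
    (essPattern μ A x).Nonempty :=
  ⟨fun _ => true, by
    rw [essPattern, Set.mem_ofPred_eq]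
    simp only [if_true]
    exact hA⟩

lemma measurable_essExp {n : ℕ} {A : Set (Fin n → Ω)} (hA : MeasurableSet A) :
    Measurable (essExp μ A) := by
  have hpat : Measurable (essPattern μ A) := by
    rw [measurable_set_iff]
    intro b
    have hmix : Measurable fun p : (Fin n → Ω) × (Fin n → Ω) =>
        (fun i => if b i then p.2 i else p.1 i) := by
      refine measurable_pi_lambda _ fun i => ?_
      by_cases hb : b i
      · simp only [hb, if_true]; fun_prop
      · simp only [hb, Bool.false_eq_true, if_false]; fun_prop
    exact measurableSet_setOfPred.1 (measurableSet_lt measurable_const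
      (measurable_measure_prodMk_left (ν := piP μ n) (hmix hA)))
  exact (measurable_of_finite fun S : Set (Fin n → Bool) =>
    ENNReal.ofReal (Real.exp (cubeDist S ^ 2 / 4))).comp hpat

lemma measurable_cons (n : ℕ) :
    Measurable fun p : Ω × (Fin n → Ω) => (Fin.cons p.1 p.2 : Fin (n + 1) → Ω) := by
  refine measurable_pi_lambda _ fun i => ?_
  refine Fin.cases ?_ (fun i => ?_) i
  · simpa using measurable_fst
  · simp only [Fin.cons_succ]; fun_prop

lemma measurePreserving_cons (n : ℕ) :
    MeasurePreserving (fun p : Ω × (Fin n → Ω) => (Fin.cons p.1 p.2 : Fin (n + 1) → Ω))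
      (μ.prod (piP μ n)) (piP μ (n + 1)) := by
  have h := (measurePreserving_piFinSuccAbove (fun _ : Fin (n + 1) => μ) 0).symm
  have he : (fun p : Ω × (Fin n → Ω) => (Fin.cons p.1 p.2 : Fin (n + 1) → Ω)) =
      (MeasurableEquiv.piFinSuccAbove (fun _ => Ω) 0).symm := by
    ext p i
    simp [MeasurableEquiv.piFinSuccAbove_symm_apply, Fin.insertNthEquiv]
  rw [he]
  exact h

lemma lintegral_piP_succ {n : ℕ} {g : (Fin (n + 1) → Ω) → ℝ≥0∞} (hg : Measurable g) :
    ∫⁻ z, g z ∂piP μ (n + 1) = ∫⁻ ω, ∫⁻ x, g (Fin.cons ω x) ∂piP μ n ∂μ := by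
  rw [← (measurePreserving_cons μ n).lintegral_comp hg]
  exact lintegral_prod _ (hg.comp (measurable_cons n)).aemeasurable

lemma piP_succ_apply {n : ℕ} {A : Set (Fin (n + 1) → Ω)} (hA : MeasurableSet A) :
    piP μ (n + 1) A = ∫⁻ ω, piP μ n {x | (Fin.cons ω x : Fin (n + 1) → Ω) ∈ A} ∂μ := by
  rw [← (measurePreserving_cons μ n).measure_preimage hA.nullMeasurableSet,
    Measure.prod_apply (measurable_cons n hA)]
  rfl

lemma piP_succ_apply_symm {n : ℕ} {A : Set (Fin (n + 1) → Ω)} (hA : MeasurableSet A) :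
    piP μ (n + 1) A = ∫⁻ x, μ {ω | (Fin.cons ω x : Fin (n + 1) → Ω) ∈ A} ∂piP μ n := by
  rw [← (measurePreserving_cons μ n).measure_preimage hA.nullMeasurableSet,
    Measure.prod_apply_symm (measurable_cons n hA)]
  rfl

/-- The essential projection of a subset of `Ω^(n+1)` onto the last `n` coordinates. -/
def essProj {n : ℕ} (A : Set (Fin (n + 1) → Ω)) : Set (Fin n → Ω) :=
  {x | 0 < μ {ω | (Fin.cons ω x : Fin (n + 1) → Ω) ∈ A}}

lemma measurable_fiber {n : ℕ} {A : Set (Fin (n + 1) → Ω)} (hA : MeasurableSet A) :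
    Measurable fun x : Fin n → Ω => μ {ω | (Fin.cons ω x : Fin (n + 1) → Ω) ∈ A} :=
  measurable_measure_prodMk_right (μ := μ) (measurable_cons n hA)

lemma measurable_section {n : ℕ} {A : Set (Fin (n + 1) → Ω)} (hA : MeasurableSet A) :
    Measurable fun ω : Ω => piP μ n {x | (Fin.cons ω x : Fin (n + 1) → Ω) ∈ A} :=
  measurable_measure_prodMk_left (ν := piP μ n) (measurable_cons n hA)

lemma measurableSet_section {n : ℕ} {A : Set (Fin (n + 1) → Ω)} (hA : MeasurableSet A) (ω : Ω) :
    MeasurableSet {x : Fin n → Ω | (Fin.cons ω x : Fin (n + 1) → Ω) ∈ A} :=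
  ((measurable_cons n).comp measurable_prodMk_left) hA

lemma measurableSet_essProj {n : ℕ} {A : Set (Fin (n + 1) → Ω)} (hA : MeasurableSet A) :
    MeasurableSet (essProj μ A) :=
  measurableSet_lt measurable_const (measurable_fiber μ hA)

lemma piP_succ_pos_iff {n : ℕ} {A : Set (Fin (n + 1) → Ω)} (hA : MeasurableSet A) :
    0 < piP μ (n + 1) A ↔ 0 < piP μ n (essProj μ A) := by
  rw [piP_succ_apply_symm μ hA, lintegral_pos_iff_support (measurable_fiber μ hA)]
  simp only [Function.support, essProj, pos_iff_ne_zero]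

lemma ae_section_le_essProj {n : ℕ} {A : Set (Fin (n + 1) → Ω)} (hA : MeasurableSet A) :
    ∀ᵐ ω ∂μ, piP μ n {x | (Fin.cons ω x : Fin (n + 1) → Ω) ∈ A} ≤ piP μ n (essProj μ A) := by
  have hD : MeasurableSet (A ∩ {z | Fin.tail z ∉ essProj μ A}) := by
    refine hA.inter (MeasurableSet.compl ?_)
    have : Measurable (Fin.tail : (Fin (n + 1) → Ω) → (Fin n → Ω)) :=
      measurable_pi_lambda _ fun i => measurable_pi_apply _
    exact this (measurableSet_essProj μ hA)
  have h0 : piP μ (n + 1) (A ∩ {z | Fin.tail z ∉ essProj μ A}) = 0 := by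
    rw [piP_succ_apply_symm μ hD]
    refine (lintegral_congr fun x => ?_).trans lintegral_zero
    by_cases hx : x ∈ essProj μ A
    · simp [hx]
    · have : μ {ω | (Fin.cons ω x : Fin (n + 1) → Ω) ∈ A} = 0 := by
        simpa [essProj] using hx
      exact measure_mono_null (fun ω hω => hω.1) this
  rw [piP_succ_apply μ hD, lintegral_eq_zero_iff (measurable_section μ hD)] at h0
  filter_upwards [h0] with ω hω
  calc piP μ n {x | (Fin.cons ω x : Fin (n + 1) → Ω) ∈ A}
      ≤ piP μ n (essProj μ A ∪ {x | (Fin.cons ω x : Fin (n + 1) → Ω) ∈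
          A ∩ {z | Fin.tail z ∉ essProj μ A}}) := by
        refine measure_mono fun x hx => ?_
        by_cases h : x ∈ essProj μ A
        · exact Or.inl h
        · exact Or.inr ⟨hx, by simpa using h⟩
    _ ≤ piP μ n (essProj μ A) + 0 := (measure_union_le _ _).trans (by gcongr; exact hω.le)
    _ = _ := add_zero _

lemma measurable_ite {n : ℕ} (b : Fin n → Bool) (x : Fin n → Ω) :
    Measurable fun y : Fin n → Ω => (fun i => if b i then y i else x i) := by
  refine measurable_pi_lambda _ fun i => ?_
  by_cases hb : b i
  · simp only [hb, if_true]; fun_prop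
  · simp only [hb, Bool.false_eq_true, if_false]; exact measurable_const

lemma cons_false_mem_essPattern {n : ℕ} {A : Set (Fin (n + 1) → Ω)} (hA : MeasurableSet A)
    (ω : Ω) (x : Fin n → Ω) (b : Fin n → Bool)
    (hb : b ∈ essPattern μ {x | (Fin.cons ω x : Fin (n + 1) → Ω) ∈ A} x) :
    (Fin.cons false b : Fin (n + 1) → Bool) ∈ essPattern μ A (Fin.cons ω x) := by
  have hm : MeasurableSet {y : Fin (n + 1) → Ω | (fun i => if (Fin.cons false b :
      Fin (n + 1) → Bool) i then y i else (Fin.cons ω x : Fin (n + 1) → Ω) i) ∈ A} :=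
    measurable_ite _ _ hA
  rw [essPattern, Set.mem_ofPred_eq, piP_succ_apply μ hm]
  simp only [Set.mem_ofPred_eq, ite_cons_cons]
  simpa [essPattern] using hb

lemma cons_true_mem_essPattern {n : ℕ} {A : Set (Fin (n + 1) → Ω)} (hA : MeasurableSet A)
    (ω : Ω) (x : Fin n → Ω) (b : Fin n → Bool) (hb : b ∈ essPattern μ (essProj μ A) x) :
    (Fin.cons true b : Fin (n + 1) → Bool) ∈ essPattern μ A (Fin.cons ω x) := by
  have hm : MeasurableSet {y : Fin (n + 1) → Ω | (fun i => if (Fin.cons true b :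
      Fin (n + 1) → Bool) i then y i else (Fin.cons ω x : Fin (n + 1) → Ω) i) ∈ A} :=
    measurable_ite _ _ hA
  rw [essPattern, Set.mem_ofPred_eq, piP_succ_pos_iff μ hm]
  simp only [essProj, Set.mem_ofPred_eq, ite_cons_cons]
  simpa [essPattern, essProj] using hb

lemma essExp_cons_le {n : ℕ} {A : Set (Fin (n + 1) → Ω)} (hA : MeasurableSet A)
    (hB : 0 < piP μ n (essProj μ A)) (ω : Ω) (x : Fin n → Ω) :
    essExp μ A (Fin.cons ω x) ≤
      ENNReal.ofReal (Real.exp (1 / 4)) * essExp μ (essProj μ A) x := by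
  have h := cubeDist_sq_le_one_add (essPattern_nonempty μ hB x)
    (cons_true_mem_essPattern μ hA ω x)
  rw [essExp, essExp, ← ENNReal.ofReal_mul (Real.exp_nonneg _), ← Real.exp_add]
  gcongr
  linarith

lemma essExp_cons_le_rpow {n : ℕ} {A : Set (Fin (n + 1) → Ω)} (hA : MeasurableSet A)
    (hB : 0 < piP μ n (essProj μ A)) {ω : Ω}
    (hω : 0 < piP μ n {x | (Fin.cons ω x : Fin (n + 1) → Ω) ∈ A})
    {a : ℝ} (ha₀ : 0 ≤ a) (ha₁ : a ≤ 1) (x : Fin n → Ω) :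
    essExp μ A (Fin.cons ω x) ≤ ENNReal.ofReal (Real.exp ((1 - a) ^ 2 / 4)) *
      (essExp μ {x | (Fin.cons ω x : Fin (n + 1) → Ω) ∈ A} x ^ a *
        essExp μ (essProj μ A) x ^ (1 - a)) := by
  have h := cubeDist_sq_le_convex (essPattern_nonempty μ hω x) (essPattern_nonempty μ hB x)
    (cons_false_mem_essPattern μ hA ω x) (cons_true_mem_essPattern μ hA ω x) ha₀ ha₁
  rw [essExp, essExp, essExp, ENNReal.ofReal_rpow_of_pos (Real.exp_pos _),
    ENNReal.ofReal_rpow_of_pos (Real.exp_pos _), ← Real.exp_mul, ← Real.exp_mul,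
    ← ENNReal.ofReal_mul (Real.exp_nonneg _), ← Real.exp_add,
    ← ENNReal.ofReal_mul (Real.exp_nonneg _), ← Real.exp_add]
  gcongr
  linarith

end Measure

lemma exp_neg_le_quadratic {u : ℝ} (hu : 0 ≤ u) : Real.exp (-u) ≤ 1 - u + u ^ 2 / 2 := by
  rw [Real.exp_neg]
  have h := Real.quadratic_le_exp_of_nonneg hu
  refine (inv_anti₀ (by positivity) h).trans ?_
  rw [inv_le_iff_one_le_mul₀ (by positivity)]
  nlinarith [pow_nonneg hu 4]

lemma exp_sub_sq_add_exp_neg_le {u : ℝ} (hu : 0 ≤ u) (hu' : u ≤ 1 / 2) :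
    Real.exp (u - u ^ 2) ≤ 2 - Real.exp (-u) := by
  have h1 := exp_neg_le_quadratic hu
  have hv : 0 ≤ u - u ^ 2 := by nlinarith
  have h2 := Real.exp_bound' hv (by nlinarith) (n := 3) (by norm_num)
  simp only [Finset.sum_range_succ, Finset.sum_range_zero, Nat.factorial] at h2
  push_cast at h2
  have h3 : (u - u ^ 2) ^ 3 ≤ u ^ 3 :=
    pow_le_pow_left₀ hv (by nlinarith) 3
  nlinarith [pow_nonneg hu 3, pow_nonneg hu 2, mul_nonneg (pow_nonneg hu 3) (sub_nonneg.2 hu')]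

/-- The optimization over the interpolation parameter in the induction step. -/
lemma exists_exp_mul_rpow_le {r : ℝ} (hr : Real.exp (-(1 / 2)) ≤ r) (hr₁ : r ≤ 1) :
    ∃ a : ℝ, 0 ≤ a ∧ a ≤ 1 ∧ Real.exp ((1 - a) ^ 2 / 4) * r ^ (-a) ≤ 2 - r := by
  have hr₀ : 0 < r := (Real.exp_pos _).trans_le hr
  have hl : -(1 / 2) ≤ Real.log r := (Real.le_log_iff_exp_le hr₀).2 hr
  have hl' : Real.log r ≤ 0 := Real.log_nonpos hr₀.le hr₁
  refine ⟨1 + 2 * Real.log r, by linarith, by linarith, ?_⟩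
  rw [Real.rpow_def_of_pos hr₀, ← Real.exp_add]
  have h := exp_sub_sq_add_exp_neg_le (u := -Real.log r) (by linarith) (by linarith)
  rw [neg_neg, Real.exp_log hr₀] at h
  convert h using 2
  ring

lemma exp_quarter_le {r : ℝ} (hr : r ≤ Real.exp (-(1 / 2))) : Real.exp (1 / 4) ≤ 2 - r := by
  have h := exp_sub_sq_add_exp_neg_le (u := 1 / 2) (by norm_num) le_rfl
  norm_num at h hr ⊢
  linarith

section Induction

variable {Ω : Type*} [MeasurableSpace Ω] (μ : Measure Ω) [IsProbabilityMeasure μ]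

lemma lintegral_essExp_cons_le {n : ℕ}
    (ih : ∀ B : Set (Fin n → Ω), MeasurableSet B → 0 < piP μ n B →
      ∫⁻ x, essExp μ B x ∂piP μ n ≤ (piP μ n B)⁻¹)
    {A : Set (Fin (n + 1) → Ω)} (hA : MeasurableSet A) (hB : 0 < piP μ n (essProj μ A)) {ω : Ω}
    (hω : piP μ n {x | (Fin.cons ω x : Fin (n + 1) → Ω) ∈ A} ≤ piP μ n (essProj μ A)) :
    ∫⁻ x, essExp μ A (Fin.cons ω x) ∂piP μ n ≤
      ENNReal.ofReal ((2 - (piP μ n).real {x | (Fin.cons ω x : Fin (n + 1) → Ω) ∈ A} /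
        (piP μ n).real (essProj μ A)) / (piP μ n).real (essProj μ A)) := by
  set C : Set (Fin n → Ω) := {x | (Fin.cons ω x : Fin (n + 1) → Ω) ∈ A}
  set B := essProj μ A
  have hBm : MeasurableSet B := measurableSet_essProj μ hA
  have hCm : MeasurableSet C := measurableSet_section hA ω
  have hb : 0 < (piP μ n).real B := ENNReal.toReal_pos hB.ne' (measure_ne_top _ _)
  have hBe : piP μ n B = ENNReal.ofReal ((piP μ n).real B) :=
    (ofReal_measureReal (measure_ne_top _ _)).symm
  have hCe : piP μ n C = ENNReal.ofReal ((piP μ n).real C) :=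
    (ofReal_measureReal (measure_ne_top _ _)).symm
  have hle : (piP μ n).real C ≤ (piP μ n).real B :=
    ENNReal.toReal_mono (measure_ne_top _ _) hω
  generalize (piP μ n).real B = b at *
  generalize (piP μ n).real C = c at *
  rcases le_total (c / b) (Real.exp (-(1 / 2))) with hr | hr
  · calc ∫⁻ x, essExp μ A (Fin.cons ω x) ∂piP μ n
        ≤ ∫⁻ x, ENNReal.ofReal (Real.exp (1 / 4)) * essExp μ B x ∂piP μ n :=
          lintegral_mono fun x => essExp_cons_le μ hA hB ω x
      _ ≤ ENNReal.ofReal (Real.exp (1 / 4)) * (piP μ n B)⁻¹ := by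
          rw [lintegral_const_mul _ (measurable_essExp μ hBm)]
          gcongr
          exact ih B hBm hB
      _ = ENNReal.ofReal (Real.exp (1 / 4) / b) := by
          rw [hBe, ← ENNReal.ofReal_inv_of_pos hb, ← ENNReal.ofReal_mul (Real.exp_nonneg _),
            ← div_eq_mul_inv]
      _ ≤ _ := by
          gcongr
          exact exp_quarter_le hr
  · have hr₀ : 0 < c / b := (Real.exp_pos _).trans_le hr
    have hc : 0 < c := by
      have := mul_pos hr₀ hb
      rwa [div_mul_cancel₀ _ hb.ne'] at this
    have hC0 : 0 < piP μ n C := by rw [hCe]; exact ENNReal.ofReal_pos.2 hc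
    obtain ⟨a, ha₀, ha₁, ha⟩ := exists_exp_mul_rpow_le hr ((div_le_one hb).2 hle)
    calc ∫⁻ x, essExp μ A (Fin.cons ω x) ∂piP μ n
        ≤ ∫⁻ x, ENNReal.ofReal (Real.exp ((1 - a) ^ 2 / 4)) *
            (essExp μ C x ^ a * essExp μ B x ^ (1 - a)) ∂piP μ n :=
          lintegral_mono fun x => essExp_cons_le_rpow μ hA hB hC0 ha₀ ha₁ x
      _ ≤ ENNReal.ofReal (Real.exp ((1 - a) ^ 2 / 4)) *
            (((piP μ n C)⁻¹) ^ a * ((piP μ n B)⁻¹) ^ (1 - a)) := by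
          refine (lintegral_const_mul _ (((measurable_essExp μ hCm).pow_const _).mul
            ((measurable_essExp μ hBm).pow_const _))).trans_le ?_
          gcongr
          refine (ENNReal.lintegral_mul_norm_pow_le (measurable_essExp μ hCm).aemeasurable
            (measurable_essExp μ hBm).aemeasurable ha₀ (sub_nonneg.2 ha₁) (by ring)).trans ?_
          have h1a := sub_nonneg.2 ha₁
          gcongr
          · exact ih C hCm hC0
          · exact ih B hBm hB
      _ = ENNReal.ofReal (Real.exp ((1 - a) ^ 2 / 4) * (c / b) ^ (-a) / b) := by
          rw [hBe, hCe, ← ENNReal.ofReal_inv_of_pos hb, ← ENNReal.ofReal_inv_of_pos hc,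
            ENNReal.ofReal_rpow_of_pos (inv_pos.2 hc), ENNReal.ofReal_rpow_of_pos (inv_pos.2 hb),
            ← ENNReal.ofReal_mul (by positivity), ← ENNReal.ofReal_mul (by positivity)]
          congr 1
          rw [Real.div_rpow hc.le hb.le, Real.inv_rpow hc.le, Real.inv_rpow hb.le,
            Real.rpow_neg hc.le, Real.rpow_neg hb.le, Real.rpow_sub hb, Real.rpow_one]
          have := Real.rpow_pos_of_pos hb a
          have := Real.rpow_pos_of_pos hc a
          field_simp
      _ ≤ _ := by gcongr

/-- Talagrand's exponential inequality for the measurable version of the convex-hull distance. -/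
theorem lintegral_essExp_le (n : ℕ) : ∀ A : Set (Fin n → Ω), MeasurableSet A → 0 < piP μ n A →
    ∫⁻ x, essExp μ A x ∂piP μ n ≤ (piP μ n A)⁻¹ := by
  induction n with
  | zero =>
    intro A _ _
    have h : ∀ x, essExp μ A x = 1 := fun x => by
      have : cubeDist (essPattern μ A x) = 0 := by
        obtain ⟨v, -, hv⟩ := exists_norm_eq_cubeDist (essPattern_nonempty μ ‹_› x)
        rw [← hv, Subsingleton.elim v 0, norm_zero]
      simp [essExp, this]
    simp only [h, lintegral_const, measure_univ, mul_one]
    exact ENNReal.one_le_inv.2 prob_le_one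
  | succ n ih =>
    intro A hA hA0
    have hB := (piP_succ_pos_iff μ hA).1 hA0
    have hb : 0 < (piP μ n).real (essProj μ A) :=
      ENNReal.toReal_pos hB.ne' (measure_ne_top _ _)
    have ha : 0 < (piP μ (n + 1)).real A := ENNReal.toReal_pos hA0.ne' (measure_ne_top _ _)
    have hp : Measurable fun ω : Ω =>
        (piP μ n).real {x | (Fin.cons ω x : Fin (n + 1) → Ω) ∈ A} :=
      (measurable_section μ hA).ennreal_toReal
    have hint : Integrable (fun ω : Ω =>
        (piP μ n).real {x | (Fin.cons ω x : Fin (n + 1) → Ω) ∈ A}) μ := by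
      refine Integrable.of_bound hp.aestronglyMeasurable 1 (.of_forall fun ω => ?_)
      rw [Real.norm_of_nonneg measureReal_nonneg]
      exact measureReal_le_one
    have hval : ∫ ω, (piP μ n).real {x | (Fin.cons ω x : Fin (n + 1) → Ω) ∈ A} ∂μ =
        (piP μ (n + 1)).real A := by
      rw [measureReal_def, piP_succ_apply μ hA]
      exact integral_toReal (measurable_section μ hA).aemeasurable
        (.of_forall fun ω => measure_lt_top _ _)
    rw [lintegral_piP_succ μ (measurable_essExp μ hA)]
    refine (lintegral_mono_ae ((ae_section_le_essProj μ hA).mono fun ω hω =>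
      lintegral_essExp_cons_le μ ih hA hB hω)).trans ?_
    have hint' : Integrable (fun ω : Ω =>
        (2 - (piP μ n).real {x | (Fin.cons ω x : Fin (n + 1) → Ω) ∈ A} /
          (piP μ n).real (essProj μ A)) / (piP μ n).real (essProj μ A)) μ :=
      ((integrable_const _).sub (hint.div_const _)).div_const _
    rw [← ofReal_integral_eq_lintegral_ofReal hint', integral_div,
      integral_sub (integrable_const _) (hint.div_const _), integral_div, hval]
    · rw [← ofReal_measureReal (μ := piP μ (n + 1)) (s := A) (measure_ne_top _ _),
        ← ENNReal.ofReal_inv_of_pos ha]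
      refine ENNReal.ofReal_le_ofReal ?_
      simp only [integral_const, measureReal_def, measure_univ, ENNReal.toReal_one, one_smul]
      rw [← measureReal_def, ← measureReal_def]
      generalize (piP μ n).real (essProj μ A) = b at *
      generalize (piP μ (n + 1)).real A = a at *
      rw [div_le_iff₀ hb, inv_mul_eq_div, le_div_iff₀ ha, sub_mul, div_mul_eq_mul_div,
        sub_le_iff_le_add, ← sub_le_iff_le_add', le_div_iff₀ hb]
      nlinarith [sq_nonneg (a - b)]
    · refine (ae_section_le_essProj μ hA).mono fun ω hω => ?_
      have hle : (piP μ n).real {x | (Fin.cons ω x : Fin (n + 1) → Ω) ∈ A} ≤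
          (piP μ n).real (essProj μ A) := ENNReal.toReal_mono (measure_ne_top _ _) hω
      have := (div_le_one hb).2 hle
      exact div_nonneg (by linarith) hb.le

lemma fConv_le_cubeDist {n : ℕ} {A : Set (Fin n → Ω)} (hA : 0 < piP μ n A) (x : Fin n → Ω) :
    fConv A x ≤ cubeDist (essPattern μ A x) := by
  refine Metric.infDist_le_infDist_of_subset (convexHull_mono ?_)
    (convexHull_nonempty_iff.2 ((essPattern_nonempty μ hA x).image _))
  rintro _ ⟨b, hb, rfl⟩
  obtain ⟨y, hy⟩ := nonempty_of_measure_ne_zero (ne_of_gt hb)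
  refine ⟨fun i => ?_, _, hy, fun i hi => ?_⟩
  · by_cases h : b i <;> simp [cubeVec, h]
  · by_cases h : b i <;> simp_all [cubeVec]

lemma ofReal_exp_fConv_le_essExp {n : ℕ} {A : Set (Fin n → Ω)} (hA : 0 < piP μ n A)
    (x : Fin n → Ω) : ENNReal.ofReal (Real.exp (fConv A x ^ 2 / 4)) ≤ essExp μ A x := by
  have h₀ : 0 ≤ fConv A x := Metric.infDist_nonneg
  have h := fConv_le_cubeDist μ hA x
  unfold essExp
  gcongr

end Induction

/-- Theorem 4.1.1 of Talagrand (convex-hull distance inequality):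
`∫* exp(f_c(A,x)²/4) dP(x) ≤ 1/P(A)`; in particular, for `t > 0`,
`P*(f_c(A,·) > t) ≤ (1/P(A)) e^{-t²/4}`. -/
theorem talagrand_stmt13 {Ω : Type*} [MeasurableSpace Ω] (μ : Measure Ω)
    [IsProbabilityMeasure μ] (N : ℕ) (hN : 1 ≤ N)
    (A : Set (Fin N → Ω)) (hA : MeasurableSet A) (hA0 : 0 < piP μ N A) :
    upperLintegral (piP μ N)
        (fun x => ENNReal.ofReal (Real.exp (fConv A x ^ 2 / 4))) ≤ (piP μ N A)⁻¹ ∧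
      ∀ t : ℝ, 0 < t →
        piP μ N {x | t < fConv A x} ≤
          (piP μ N A)⁻¹ * ENNReal.ofReal (Real.exp (-t ^ 2 / 4)) := by
  have hmain := lintegral_essExp_le μ N A hA hA0
  refine ⟨?_, fun t ht => ?_⟩
  · exact (iInf₂_le_of_le (essExp μ A) (measurable_essExp μ hA)
      (iInf_le _ (ofReal_exp_fConv_le_essExp μ hA0))).trans hmain
  · have hsub : {x | t < fConv A x} ⊆
        {x | ENNReal.ofReal (Real.exp (t ^ 2 / 4)) ≤ essExp μ A x} := by
      intro x hx
      refine le_trans ?_ (ofReal_exp_fConv_le_essExp μ hA0 x)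
      have hx' : t ≤ fConv A x := le_of_lt hx
      gcongr
    have hmk := (mul_meas_ge_le_lintegral (μ := piP μ N) (measurable_essExp μ hA)
      (ENNReal.ofReal (Real.exp (t ^ 2 / 4)))).trans hmain
    rw [neg_div, Real.exp_neg, ENNReal.ofReal_inv_of_pos (Real.exp_pos _), ← div_eq_mul_inv]
    refine (measure_mono hsub).trans ?_
    rwa [ENNReal.le_div_iff_mul_le (Or.inl (ENNReal.ofReal_pos.2 (Real.exp_pos _)).ne')
      (Or.inl ENNReal.ofReal_ne_top), mul_comm]
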